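/- Let A > 0 and let Y have the symmetric two-component Gaussian mixture density f(y) = (1/2)(φ(y − A) + φ(y + A)), where φ is the standard normal density. Then the differential entropy of Y satisfies −∫_ℝ f(y) ln f(y) dy = (1/2) ln(2πe) + A² − I(A), where I(A) = (2/(√(2π) A)) e^{−A²/2} ∫_0^∞ e^{−y²/(2A²)} cosh(y) ln(cosh(y)) dy. -/

import Mathlib

open MeasureTheory ProbabilityTheory Real Filter Set
open scoped Classical

noncomputable section

/-- The standard normal density `φ`. -/
def stdPhi (x : ℝ) : ℝ := (Real.sqrt (2 * π))⁻¹ * Real.exp (-x ^ 2 / 2)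

/-- The standard normal cumulative distribution function `Φ`. -/
def stdCdf (x : ℝ) : ℝ := ∫ u in Set.Iio x, stdPhi u

/-- `I(A) = (2/(√(2π) A)) e^{−A²/2} ∫_0^∞ e^{−y²/(2A²)} cosh(y) ln(cosh(y)) dy`. -/
def Ifun (A : ℝ) : ℝ :=
  2 / (Real.sqrt (2 * π) * A) * Real.exp (-A ^ 2 / 2) *
    ∫ y in Set.Ioi (0 : ℝ), Real.exp (-y ^ 2 / (2 * A ^ 2)) * Real.cosh y * Real.log (Real.cosh y)

/-- The standard normal density, translated by `m`, is the density of the normal law of mean `m`. -/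
lemma stdPhi_sub_eq_gaussianPDFReal (m y : ℝ) : stdPhi (y - m) = gaussianPDFReal m 1 y := by
  simp [stdPhi, gaussianPDFReal]

lemma integrable_stdPhi_sub (m : ℝ) : Integrable fun y ↦ stdPhi (y - m) := by
  simpa only [stdPhi_sub_eq_gaussianPDFReal] using integrable_gaussianPDFReal m 1

lemma integral_stdPhi_sub (m : ℝ) : ∫ y, stdPhi (y - m) = 1 := by
  simpa only [stdPhi_sub_eq_gaussianPDFReal] using integral_gaussianPDFReal_eq_one m one_ne_zero

lemma integrable_stdPhi_sub_mul_sq (m : ℝ) : Integrable fun y ↦ stdPhi (y - m) * y ^ 2 := by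
  have h := (memLp_id_gaussianReal (μ := m) (v := 1) 2).integrable_sq
  rw [gaussianReal_of_var_ne_zero m one_ne_zero,
    integrable_withDensity_iff (measurable_gaussianPDF m 1)
      (ae_of_all _ fun _ ↦ gaussianPDF_lt_top)] at h
  simpa only [toReal_gaussianPDF, stdPhi_sub_eq_gaussianPDFReal, id, mul_comm] using h

lemma integral_stdPhi_sub_mul_sq (m : ℝ) : ∫ y, stdPhi (y - m) * y ^ 2 = 1 + m ^ 2 := by
  have hv := variance_eq_sub (memLp_id_gaussianReal (μ := m) (v := 1) 2)
  have hs : ∫ y, y ^ 2 ∂gaussianReal m 1 = ∫ y, stdPhi (y - m) * y ^ 2 := by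
    simp only [integral_gaussianReal_eq_integral_smul one_ne_zero, smul_eq_mul,
      stdPhi_sub_eq_gaussianPDFReal]
  simp only [variance_id_gaussianReal, Pi.pow_apply, id, integral_id_gaussianReal, hs,
    NNReal.coe_one] at hv
  linarith

/-- The density of the symmetric mixture of the normal laws of means `A` and `-A`. -/
def mixtureDensity (A y : ℝ) : ℝ := 1 / 2 * (stdPhi (y - A) + stdPhi (y + A))

lemma mixtureDensity_eq_sub (A y : ℝ) :
    mixtureDensity A y = 1 / 2 * (stdPhi (y - A) + stdPhi (y - -A)) := by
  rw [mixtureDensity, sub_neg_eq_add]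

lemma mixtureDensity_eq_cosh (A y : ℝ) :
    mixtureDensity A y = (√(2 * π))⁻¹ * exp (-y ^ 2 / 2) * exp (-A ^ 2 / 2) * cosh (A * y) := by
  have h₁ : exp (-(y - A) ^ 2 / 2) = exp (-y ^ 2 / 2) * exp (-A ^ 2 / 2) * exp (A * y) := by
    rw [← exp_add, ← exp_add]; ring_nf
  have h₂ : exp (-(y + A) ^ 2 / 2) = exp (-y ^ 2 / 2) * exp (-A ^ 2 / 2) * exp (-(A * y)) := by
    rw [← exp_add, ← exp_add]; ring_nf
  rw [mixtureDensity, stdPhi, stdPhi, h₁, h₂, cosh_eq]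
  ring

lemma mixtureDensity_nonneg (A y : ℝ) : 0 ≤ mixtureDensity A y := by
  have := cosh_pos (A * y)
  rw [mixtureDensity_eq_cosh]
  positivity

lemma continuous_mixtureDensity (A : ℝ) : Continuous (mixtureDensity A) := by
  unfold mixtureDensity stdPhi
  fun_prop

lemma log_mixtureDensity (A y : ℝ) :
    log (mixtureDensity A y) =
      -(1 / 2 * log (2 * π)) - y ^ 2 / 2 - A ^ 2 / 2 + log (cosh (A * y)) := by
  have hs : (√(2 * π))⁻¹ ≠ 0 := by positivity
  rw [mixtureDensity_eq_cosh, log_mul (by positivity) (cosh_pos _).ne',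
    log_mul (by positivity) (exp_ne_zero _), log_mul hs (exp_ne_zero _), log_inv,
    log_sqrt (by positivity), log_exp, log_exp]
  ring

lemma integrable_mixtureDensity (A : ℝ) : Integrable (mixtureDensity A) := by
  rw [funext (mixtureDensity_eq_sub A)]
  exact ((integrable_stdPhi_sub A).add (integrable_stdPhi_sub (-A))).const_mul _

lemma integral_mixtureDensity (A : ℝ) : ∫ y, mixtureDensity A y = 1 := by
  simp only [mixtureDensity_eq_sub]
  rw [integral_const_mul, integral_add (integrable_stdPhi_sub A) (integrable_stdPhi_sub (-A)),
    integral_stdPhi_sub, integral_stdPhi_sub]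
  norm_num

lemma integrable_mixtureDensity_mul_sq (A : ℝ) :
    Integrable fun y ↦ mixtureDensity A y * y ^ 2 := by
  simp only [mixtureDensity_eq_sub, mul_assoc, add_mul]
  exact ((integrable_stdPhi_sub_mul_sq A).add (integrable_stdPhi_sub_mul_sq (-A))).const_mul _

lemma integral_mixtureDensity_mul_sq (A : ℝ) :
    ∫ y, mixtureDensity A y * y ^ 2 = 1 + A ^ 2 := by
  simp only [mixtureDensity_eq_sub, mul_assoc, add_mul]
  rw [integral_const_mul,
    integral_add (integrable_stdPhi_sub_mul_sq A) (integrable_stdPhi_sub_mul_sq (-A)),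
    integral_stdPhi_sub_mul_sq, integral_stdPhi_sub_mul_sq]
  ring

lemma integrable_mixtureDensity_mul_log_cosh (A : ℝ) :
    Integrable fun y ↦ mixtureDensity A y * log (cosh (A * y)) := by
  refine ((integrable_mixtureDensity_mul_sq A).const_mul (A ^ 2 / 2)).mono'
    ((continuous_mixtureDensity A).mul
      (Continuous.log (by fun_prop) fun y ↦ (cosh_pos _).ne')).aestronglyMeasurable
    (ae_of_all _ fun y ↦ ?_)
  have h₀ := log_nonneg (one_le_cosh (A * y))
  have h₁ : log (cosh (A * y)) ≤ (A * y) ^ 2 / 2 :=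
    (log_le_iff_le_exp (cosh_pos _)).2 (cosh_le_exp_half_sq _)
  have hf := mixtureDensity_nonneg A y
  rw [norm_of_nonneg (mul_nonneg hf h₀)]
  nlinarith [mul_le_mul_of_nonneg_left h₁ hf]

lemma integral_mixtureDensity_mul_log_cosh (A : ℝ) (hA : 0 < A) :
    ∫ y, mixtureDensity A y * log (cosh (A * y)) = Ifun A := by
  set g : ℝ → ℝ := fun u ↦ exp (-u ^ 2 / (2 * A ^ 2)) * cosh u * log (cosh u) with hg
  have h : ∀ y, mixtureDensity A y * log (cosh (A * y)) =
      (√(2 * π))⁻¹ * exp (-A ^ 2 / 2) * g (A * |y|) := by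
    intro y
    have hy : cosh (A * |y|) = cosh (A * y) := by
      rw [← cosh_abs (A * y), abs_mul, abs_of_pos hA]
    have he : -(A * |y|) ^ 2 / (2 * A ^ 2) = -y ^ 2 / 2 := by
      rw [mul_pow, sq_abs]
      field_simp
    rw [hg, mixtureDensity_eq_cosh]
    simp only [hy, he]
    ring
  simp only [h]
  rw [integral_const_mul, integral_comp_abs (f := fun y ↦ g (A * y)),
    integral_comp_mul_left_Ioi g 0 hA, mul_zero, Ifun, smul_eq_mul]
  change _ = _ * ∫ y in Ioi 0, g y
  generalize ∫ y in Ioi 0, g y = c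
  field_simp

/-- Differential entropy of the symmetric two-component Gaussian mixture:
`h(Y) = (1/2) ln(2πe) + A² − I(A)`. -/
theorem stmt9 (A : ℝ) (hA : 0 < A) :
    -∫ y : ℝ, (1 / 2 * (stdPhi (y - A) + stdPhi (y + A))) *
        Real.log (1 / 2 * (stdPhi (y - A) + stdPhi (y + A))) =
      1 / 2 * Real.log (2 * π * Real.exp 1) + A ^ 2 - Ifun A := by
  have hint : ∀ y, mixtureDensity A y * log (mixtureDensity A y) =
      -(1 / 2 * log (2 * π) + A ^ 2 / 2) * mixtureDensity A y
        + -(1 / 2) * (mixtureDensity A y * y ^ 2)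
        + mixtureDensity A y * log (cosh (A * y)) := by
    intro y
    rw [log_mixtureDensity]
    ring
  have h₀ := (integrable_mixtureDensity A).const_mul (-(1 / 2 * log (2 * π) + A ^ 2 / 2))
  have h₂ := (integrable_mixtureDensity_mul_sq A).const_mul (-(1 / 2))
  change -∫ y, mixtureDensity A y * log (mixtureDensity A y) = _
  simp only [hint]
  rw [integral_add (by exact h₀.add h₂) (integrable_mixtureDensity_mul_log_cosh A),
    integral_add h₀ h₂, integral_const_mul, integral_const_mul, integral_mixtureDensity,
    integral_mixtureDensity_mul_sq, integral_mixtureDensity_mul_log_cosh A hA,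
    log_mul (by positivity) (exp_ne_zero 1), log_exp]
  ring

end
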